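/- There is a computable function h such that for all m, e ∈ ℕ, h(m,e) codes a u.c.e. family F_{m,e} satisfying: (1) if W_e is coinfinite, then F_{m,e} is TxtEx*-learnable by some learner but is not TxtEx*-learned by the m-th learner M_m; and (2) there is a single computable learner N that TxtEx*-learns F_{m,e} simultaneously for every m and every e with W_e cofinite. -/

import Mathlib

/-- `Wset e` is the `e`-th computably enumerable set: the domain of the `e`-th
partial computable function in the standard numbering by codes. -/
def Wset (e : ℕ) : Set ℕ :=
  {x | ((Denumerable.ofNat Nat.Partrec.Code e).eval x).Dom}

/-- The `i`-th column `{x : ⟨i,x⟩ ∈ W_a}` of the c.e. set coded by `a`;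
the number `a` codes the u.c.e. family whose members are its columns. -/
def column (a i : ℕ) : Set ℕ := {x | Nat.pair i x ∈ Wset a}

/-- The initial segment of length `n` of an enumeration `f`. -/
def initSeg (f : ℕ → ℕ) (n : ℕ) : List ℕ := (List.range n).map f

/-- The `m`-th computable learner in the standard effective enumeration of all
partial computable functions from finite sequences to ℕ. -/
def learnerOfCode (m : ℕ) : List ℕ →. ℕ :=
  fun σ => (Denumerable.ofNat Nat.Partrec.Code m).eval (Encodable.encode σ)

/-- `M` TxtFin-identifies the enumeration `f` (here `Option.none` plays the
role of the symbol `?`). -/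
def TxtFinIdentifies (M : List ℕ →. Option ℕ) (f : ℕ → ℕ) : Prop :=
  ∃ n h, (∀ n' < n, M (initSeg f n') = Part.some Option.none) ∧
    M (initSeg f n) = Part.some (Option.some h) ∧ Wset h = Set.range f

/-- `M` TxtFin-learns the set `S`. -/
def TxtFinLearnsSet (M : List ℕ →. Option ℕ) (S : Set ℕ) : Prop :=
  ∀ f : ℕ → ℕ, Set.range f = S → TxtFinIdentifies M f

/-- `M` TxtEx-identifies the enumeration `f`. -/
def TxtExIdentifies (M : List ℕ →. ℕ) (f : ℕ → ℕ) : Prop :=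
  ∃ n, (∃ N, ∀ i ≥ N, M (initSeg f i) = Part.some n) ∧ Wset n = Set.range f

/-- `M` TxtEx-learns the set `S`. -/
def TxtExLearnsSet (M : List ℕ →. ℕ) (S : Set ℕ) : Prop :=
  ∀ f : ℕ → ℕ, Set.range f = S → TxtExIdentifies M f

/-- `M` TxtBC-identifies the enumeration `f`. -/
def TxtBCIdentifies (M : List ℕ →. ℕ) (f : ℕ → ℕ) : Prop :=
  ∃ N, ∀ i ≥ N, ∃ h, M (initSeg f i) = Part.some h ∧ Wset h = Set.range f

/-- `M` TxtBC-learns the set `S`. -/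
def TxtBCLearnsSet (M : List ℕ →. ℕ) (S : Set ℕ) : Prop :=
  ∀ f : ℕ → ℕ, Set.range f = S → TxtBCIdentifies M f

/-- `M` TxtEx*-identifies the enumeration `f`. -/
def TxtExStarIdentifies (M : List ℕ →. ℕ) (f : ℕ → ℕ) : Prop :=
  ∃ n, (∃ N, ∀ i ≥ N, M (initSeg f i) = Part.some n) ∧
    (symmDiff (Wset n) (Set.range f)).Finite

/-- `M` TxtEx*-learns the set `S`. -/
def TxtExStarLearnsSet (M : List ℕ →. ℕ) (S : Set ℕ) : Prop :=
  ∀ f : ℕ → ℕ, Set.range f = S → TxtExStarIdentifies M f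

/-- Indices of cofinite c.e. sets. -/
def COF : Set ℕ := {e | (Wset e)ᶜ.Finite}

/-- Indices of coinfinite c.e. sets. -/
def COINF : Set ℕ := {e | (Wset e)ᶜ.Infinite}

/-- `P` is Σ⁰₃: definable by `∃∀∃` over a computable relation. -/
def IsSigma3 (P : Set ℕ) : Prop :=
  ∃ R : ℕ → ℕ → ℕ → ℕ → Bool,
    Computable (fun p : ℕ × ℕ × ℕ × ℕ => R p.1 p.2.1 p.2.2.1 p.2.2.2) ∧
    ∀ e, e ∈ P ↔ ∃ x, ∀ y, ∃ z, R e x y z = true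

/-- `P` is Σ⁰₄: definable by `∃∀∃∀` over a computable relation. -/
def IsSigma4 (P : Set ℕ) : Prop :=
  ∃ R : ℕ → ℕ → ℕ → ℕ → ℕ → Bool,
    Computable (fun p : ℕ × ℕ × ℕ × ℕ × ℕ =>
      R p.1 p.2.1 p.2.2.1 p.2.2.2.1 p.2.2.2.2) ∧
    ∀ e, e ∈ P ↔ ∃ x, ∀ y, ∃ z, ∀ w, R e x y z w = true

/-- `P` is Σ⁰₅: definable by `∃∀∃∀∃` over a computable relation. -/
def IsSigma5 (P : Set ℕ) : Prop :=
  ∃ R : ℕ → ℕ → ℕ → ℕ → ℕ → ℕ → Bool,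
    Computable (fun p : ℕ × ℕ × ℕ × ℕ × ℕ × ℕ =>
      R p.1 p.2.1 p.2.2.1 p.2.2.2.1 p.2.2.2.2.1 p.2.2.2.2.2) ∧
    ∀ e, e ∈ P ↔ ∃ x, ∀ y, ∃ z, ∀ w, ∃ v, R e x y z w v = true

/-- `f : ℕ → ℕ` is Δ⁰₂: the pointwise limit of a computable function. -/
def IsDelta2Fun (f : ℕ → ℕ) : Prop :=
  ∃ g : ℕ → ℕ → ℕ, Computable₂ g ∧ ∀ x, ∃ s₀, ∀ s ≥ s₀, g s x = f x

section RecursivelyEnumerable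

variable {α β : Type*} [Primcodable α] [Primcodable β]

theorem Part.assert_some_dom {γ : Type*} {p : Prop} {c : γ} :
    (Part.assert p fun _ => Part.some c).Dom ↔ p := by
  simp [Part.assert]

theorem REPred.comp {p : β → Prop} (hp : REPred p) {f : α → β} (hf : Computable f) :
    REPred fun a => p (f a) :=
  Partrec.comp hp hf

theorem REPred.or {p q : α → Prop} (hp : REPred p) (hq : REPred q) :
    REPred fun a => p a ∨ q a := by
  obtain ⟨k, hk, H⟩ := Partrec.merge hp hq fun _ _ _ _ _ => rfl
  refine hk.dom_re.of_eq fun a => ?_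
  simp [Part.dom_iff_mem, H]

theorem REPred.and {p q : α → Prop} (hp : REPred p) (hq : REPred q) :
    REPred fun a => p a ∧ q a := by
  refine (Partrec.bind hp (hq.comp Computable.fst).to₂).dom_re.of_eq fun a => ?_
  simp [Part.assert_some_dom]

theorem REPred.forall_lt {p : α → ℕ → Prop} (hp : REPred fun x : α × ℕ => p x.1 x.2)
    {f : α → ℕ} (hf : Computable f) : REPred fun a => ∀ j < f a, p a j := by
  have := Partrec.nat_rec hf (Computable.const ()).partrec
    (hp.comp (Computable.fst.pair (Computable.fst.comp Computable.snd)) :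
      Partrec fun x : α × (ℕ × Unit) => Part.assert (p x.1 x.2.1) fun _ => Part.some ()).to₂
  refine this.dom_re.of_eq fun a => ?_
  induction f a with
  | zero => simp
  | succ n ih =>
    simp only [Part.bind_dom, Part.assert_some_dom, exists_prop, Nat.forall_lt_succ_right]
    exact and_congr_left' ih

theorem REPred.exists_nat {p : α → ℕ → Bool} (hp : Computable₂ p) :
    REPred fun a => ∃ t, p a t = true := by
  refine (Partrec.rfind hp.partrec₂).dom_re.of_eq fun a => ?_
  simp [Nat.rfind_dom]

end RecursivelyEnumerable

namespace TxtExStar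

open Nat.Partrec Denumerable

section Indices

theorem rePred_mem_Wset {α : Type*} [Primcodable α] {f g : α → ℕ} (hf : Computable f)
    (hg : Computable g) : REPred fun x => g x ∈ Wset (f x) :=
  (Code.eval_part.comp ((Computable.ofNat Code).comp hf) hg).dom_re

/-- The s-m-n theorem for sets. -/
theorem exists_computable_Wset {p : ℕ → ℕ → Prop} (hp : REPred fun x : ℕ × ℕ => p x.1 x.2) :
    ∃ g : ℕ → ℕ, Computable g ∧ ∀ a, Wset (g a) = {x | p a x} := by
  have hp' : Partrec fun x : ℕ => Part.assert (p x.unpair.1 x.unpair.2) fun _ => Part.some 0 := by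
    refine ((hp.comp Computable.unpair).map (Computable.const 0).to₂).of_eq fun x => ?_
    ext; simp [eq_comm]
  obtain ⟨c, hc⟩ := Code.exists_code.1 (Partrec.nat_iff.1 hp')
  refine ⟨fun a => Encodable.encode (Code.curry c a),
    Computable.encode.comp (Code.primrec₂_curry.to_comp.comp (Computable.const c) Computable.id),
    fun a => ?_⟩
  ext x
  simp [Wset, Code.eval_curry, hc, Part.assert_some_dom]

theorem exists_column_eq_Wset (a i : ℕ) : ∃ b, Wset b = column a i := by
  refine ⟨Encodable.encode (Code.curry (ofNat Code a) i), ?_⟩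
  ext x
  simp [Wset, column, Code.eval_curry]

theorem exists_Wset_eq_univ : ∃ u, Wset u = Set.univ := by
  obtain ⟨g, -, hg⟩ := exists_computable_Wset (p := fun _ _ => True)
    ((Computable.const ()).partrec.of_eq fun _ => by ext; simp)
  exact ⟨g 0, by simp [hg]⟩

end Indices

section Texts

theorem mem_initSeg {f : ℕ → ℕ} {n a : ℕ} : a ∈ initSeg f n ↔ ∃ i < n, f i = a := by
  simp [initSeg]

theorem txtExStarLearnsSet_empty (M : List ℕ →. ℕ) : TxtExStarLearnsSet M ∅ := fun f hf =>
  absurd hf (Set.range_nonempty f).ne_empty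

theorem txtExStarLearnsSet_const {u : ℕ} (hu : Wset u = Set.univ) {S : Set ℕ}
    (hS : Sᶜ.Finite) : TxtExStarLearnsSet (fun _ => Part.some u) S := by
  rintro f rfl
  refine ⟨u, ⟨0, fun _ _ => rfl⟩, ?_⟩
  rwa [hu, ← Set.top_eq_univ, top_symmDiff]

/-- `ℕ` and a c.e. set other than `ℕ` are learnable together. -/
theorem exists_learner_univ_and (b : ℕ) (hb : Wset b ≠ Set.univ) :
    ∃ M : List ℕ →. ℕ, Partrec M ∧ TxtExStarLearnsSet M Set.univ ∧
      TxtExStarLearnsSet M (Wset b) := by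
  obtain ⟨u, hu⟩ := exists_Wset_eq_univ
  obtain ⟨a, ha⟩ := (Set.ne_univ_iff_exists_notMem _).1 hb
  have hmem : PrimrecPred fun σ : List ℕ => ∃ x ∈ σ, x = a :=
    PrimrecPred.exists_mem_list (PrimrecRel.comp Primrec.eq Primrec.id (Primrec.const a))
  classical
  refine ⟨fun σ => Part.some (if ∃ x ∈ σ, x = a then u else b),
    (Primrec.ite hmem (Primrec.const u) (Primrec.const b)).to_comp.partrec, ?_, ?_⟩
  · intro f hf
    obtain ⟨k, hk⟩ : a ∈ Set.range f := hf ▸ Set.mem_univ a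
    refine ⟨u, ⟨k + 1, fun i hi => ?_⟩, by simp [hu, hf]⟩
    simp only [exists_eq_right]
    rw [if_pos (mem_initSeg.2 ⟨k, hi, hk⟩)]
  · intro f hf
    refine ⟨b, ⟨0, fun i _ => ?_⟩, by simp [hf]⟩
    simp only [exists_eq_right]
    rw [if_neg]
    rintro h
    obtain ⟨j, -, hj⟩ := mem_initSeg.1 h
    exact ha (hf ▸ ⟨j, hj⟩)

/-- The text that starts with `σ` and continues with `g`. -/
def prepend (σ : List ℕ) (g : ℕ → ℕ) (i : ℕ) : ℕ := σ.getD i (g (i - σ.length))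

theorem initSeg_prepend (σ : List ℕ) (g : ℕ → ℕ) (k : ℕ) :
    initSeg (prepend σ g) (σ.length + k) = σ ++ initSeg g k := by
  apply List.ext_getElem
  · simp [initSeg]
  · intro i h₁ h₂
    by_cases hi : i < σ.length
    · simp [initSeg, prepend, hi]
    · simp [initSeg, prepend, hi, List.getElem_append]

theorem range_prepend {σ : List ℕ} {g : ℕ → ℕ} (h : ∀ x ∈ σ, x ∈ Set.range g) :
    Set.range (prepend σ g) = Set.range g := by
  ext x
  constructor
  · rintro ⟨i, rfl⟩
    by_cases hi : i < σ.length
    · simpa [prepend, hi] using h _ (List.getElem_mem hi)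
    · exact ⟨i - σ.length, by simp [prepend, hi]⟩
  · rintro ⟨i, rfl⟩
    exact ⟨σ.length + i, by simp [prepend]⟩

/-- `M` gives two different answers on extensions of `σ`. -/
def Unlocked (M : List ℕ →. ℕ) (σ : List ℕ) : Prop :=
  ∃ τ₁ τ₂ a b, a ∈ M (σ ++ τ₁) ∧ b ∈ M (σ ++ τ₂) ∧ a ≠ b

theorem eventually_mem_of_learns {M : List ℕ →. ℕ} {A : Set ℕ} (hA : A.Nonempty)
    (hM : TxtExStarLearnsSet M A) {σ : List ℕ} (hσ : ∀ x ∈ σ, x ∈ A) :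
    ∃ n τ, n ∈ M (σ ++ τ) ∧ (symmDiff (Wset n) A).Finite := by
  obtain ⟨g, rfl⟩ := A.to_countable.exists_eq_range hA
  obtain ⟨n, ⟨N, hN⟩, hn⟩ := hM _ (range_prepend hσ)
  refine ⟨n, initSeg g N, ?_, by rwa [range_prepend hσ] at hn⟩
  rw [← initSeg_prepend, hN _ (Nat.le_add_left _ _)]
  exact Part.mem_some n

theorem symmDiff_finite_of_not_unlocked {M : List ℕ →. ℕ} {σ : List ℕ} (h : ¬ Unlocked M σ)
    {A B : Set ℕ} (hA : A.Nonempty) (hB : B.Nonempty) (hσA : ∀ x ∈ σ, x ∈ A)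
    (hσB : ∀ x ∈ σ, x ∈ B) (hMA : TxtExStarLearnsSet M A) (hMB : TxtExStarLearnsSet M B) :
    (symmDiff A B).Finite := by
  obtain ⟨a, τ₁, ha, hWA⟩ := eventually_mem_of_learns hA hMA hσA
  obtain ⟨b, τ₂, hb, hWB⟩ := eventually_mem_of_learns hB hMB hσB
  obtain rfl : a = b := by
    by_contra hab
    exact h ⟨τ₁, τ₂, a, b, ha, hb, hab⟩
  rw [symmDiff_comm] at hWA
  exact (hWA.union hWB).subset (symmDiff_triangle A (Wset a) B)

/-- A learner of `ℕ` has a locking sequence. -/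
theorem exists_not_unlocked {M : List ℕ →. ℕ} (hM : TxtExStarLearnsSet M Set.univ) :
    ∃ σ, ¬ Unlocked M σ := by
  by_contra! hU
  have step : ∀ (σ : List ℕ) (k : ℕ), ∃ τ, ∃ a ∈ M (σ ++ k :: τ), a ∉ M σ := by
    intro σ k
    obtain ⟨τ₁, τ₂, a, b, ha, hb, hab⟩ := hU (σ ++ [k])
    rw [List.append_assoc, List.singleton_append] at ha hb
    by_cases h : a ∈ M σ
    · exact ⟨τ₂, b, hb, fun h' => hab (Part.mem_unique h h')⟩
    · exact ⟨τ₁, a, ha, h⟩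
  choose t ht using step
  let s : ℕ → List ℕ := fun k => Nat.rec [] (fun k σ => σ ++ k :: t σ k) k
  have s_succ (k) : s (k + 1) = s k ++ k :: t (s k) k := rfl
  have s_mono {i j} (hij : i ≤ j) : s i <+: s j := by
    induction j, hij using Nat.le_induction with
    | base => exact List.prefix_rfl
    | succ j _ ih => exact ih.trans (List.prefix_append _ _)
  have s_length (k) : k ≤ (s k).length := by
    induction k with
    | zero => simp
    | succ k ih => simp [s_succ]; omega
  let f : ℕ → ℕ := fun i => (s (i + 1))[i]'(s_length (i + 1))
  have f_eq {i k} (h : i < (s k).length) : f i = (s k)[i] := by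
    rcases le_total (i + 1) k with hik | hik
    · exact (s_mono hik).getElem _
    · exact ((s_mono hik).getElem _).symm
  have f_init (k) : initSeg f (s k).length = s k := by
    apply List.ext_getElem
    · simp [initSeg]
    · intro i _ h
      simp [initSeg, f_eq h]
  have f_range : Set.range f = Set.univ := by
    refine Set.eq_univ_of_forall fun k => ?_
    have h : (s k).length < (s (k + 1)).length := by simp [s_succ]
    exact ⟨(s k).length, by rw [f_eq (k := k + 1) h]; simp [s_succ]⟩
  obtain ⟨n, ⟨N, hN⟩, -⟩ := hM f f_range
  obtain ⟨a, ha, ha'⟩ := ht (s N) N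
  have h₀ := hN (s N).length (s_length N)
  have h₁ := hN (s (N + 1)).length ((Nat.le_succ N).trans (s_length _))
  rw [f_init N] at h₀
  rw [f_init (N + 1), s_succ] at h₁
  rw [h₁] at ha
  rw [h₀] at ha'
  exact ha' ha

end Texts

/-- A computable check whether `t` codes a witness for `Unlocked (learnerOfCode m) σ`. -/
def unlockedAt (x : ℕ × List ℕ) (t : ℕ) : Bool :=
  let w := ofNat (ℕ × List ℕ × List ℕ) t
  let o₁ := Code.evaln w.1 (ofNat Code x.1) (Encodable.encode (x.2 ++ w.2.1))
  let o₂ := Code.evaln w.1 (ofNat Code x.1) (Encodable.encode (x.2 ++ w.2.2))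
  o₁.isSome && (o₂.isSome && !decide (o₁ = o₂))

theorem computable₂_unlockedAt : Computable₂ unlockedAt := by
  have hw : Primrec fun p : (ℕ × List ℕ) × ℕ => ofNat (ℕ × List ℕ × List ℕ) p.2 :=
    (Primrec.ofNat _).comp Primrec.snd
  have ho {f : (ℕ × List ℕ) × ℕ → List ℕ} (hf : Primrec f) :
      Primrec fun p : (ℕ × List ℕ) × ℕ =>
        Code.evaln (ofNat (ℕ × List ℕ × List ℕ) p.2).1 (ofNat Code p.1.1)
          (Encodable.encode (p.1.2 ++ f p)) :=
    Code.primrec_evaln.comp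
      (((Primrec.fst.comp hw).pair
        ((Primrec.ofNat Code).comp (Primrec.fst.comp Primrec.fst))).pair
        (Primrec.encode.comp (Primrec.list_append.comp (Primrec.snd.comp Primrec.fst) hf)))
  have h₁ := ho (Primrec.fst.comp (Primrec.snd.comp hw))
  have h₂ := ho (Primrec.snd.comp (Primrec.snd.comp hw))
  exact (Primrec.and.comp (Primrec.option_isSome.comp h₁)
    (Primrec.and.comp (Primrec.option_isSome.comp h₂)
      (Primrec.not.comp (Primrec.eq.comp h₁ h₂).decide))).to_comp

theorem exists_unlockedAt_iff (x : ℕ × List ℕ) :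
    (∃ t, unlockedAt x t = true) ↔ Unlocked (learnerOfCode x.1) x.2 := by
  constructor
  · rintro ⟨t, ht⟩
    simp only [unlockedAt, Bool.and_eq_true, Option.isSome_iff_exists, Bool.not_eq_true',
      decide_eq_false_iff_not] at ht
    obtain ⟨⟨a, ha⟩, ⟨b, hb⟩, hab⟩ := ht
    exact ⟨_, _, a, b, Code.evaln_sound ha, Code.evaln_sound hb, fun h => hab (by rw [ha, hb, h])⟩
  · rintro ⟨τ₁, τ₂, a, b, ha, hb, hab⟩
    obtain ⟨k₁, h₁⟩ := Code.evaln_complete.1 ha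
    obtain ⟨k₂, h₂⟩ := Code.evaln_complete.1 hb
    have h₁' := Option.mem_def.1 (Code.evaln_mono (le_max_left k₁ k₂) h₁)
    have h₂' := Option.mem_def.1 (Code.evaln_mono (le_max_right k₁ k₂) h₂)
    exact ⟨Encodable.encode (max k₁ k₂, τ₁, τ₂), by simp [unlockedAt, h₁', h₂', hab]⟩

theorem rePred_unlocked {α : Type*} [Primcodable α] {f : α → ℕ} {g : α → List ℕ}
    (hf : Computable f) (hg : Computable g) :
    REPred fun x => Unlocked (learnerOfCode (f x)) (g x) :=
  ((REPred.exists_nat computable₂_unlockedAt).comp (hf.pair hg)).of_eq fun x =>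
    exists_unlockedAt_iff (f x, g x)

/-- The members of the diagonal family: `ℕ` at index `0`. At index `n + 1`, once all earlier
sequences have been found unlocked for the `m`-th learner, the content of the `n`-th sequence
together with `W_e` (and `0`, for nonemptiness), which becomes `ℕ` if the `n`-th sequence is also
found unlocked. -/
def diagonalSet (m e i : ℕ) : Set ℕ :=
  {y | i = 0 ∨ ((∀ j < i - 1, Unlocked (learnerOfCode m) (ofNat (List ℕ) j)) ∧
    ((∃ z ∈ 0 :: ofNat (List ℕ) (i - 1), z = y) ∨ y ∈ Wset e ∨
      Unlocked (learnerOfCode m) (ofNat (List ℕ) (i - 1))))}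

theorem rePred_diagonalSet :
    REPred fun x : (ℕ × ℕ) × (ℕ × ℕ) => x.2.2 ∈ diagonalSet x.1.1 x.1.2 x.2.1 := by
  have hm : Primrec fun x : (ℕ × ℕ) × (ℕ × ℕ) => x.1.1 := Primrec.fst.comp Primrec.fst
  have he : Primrec fun x : (ℕ × ℕ) × (ℕ × ℕ) => x.1.2 := Primrec.snd.comp Primrec.fst
  have hi : Primrec fun x : (ℕ × ℕ) × (ℕ × ℕ) => x.2.1 := Primrec.fst.comp Primrec.snd
  have hy : Primrec fun x : (ℕ × ℕ) × (ℕ × ℕ) => x.2.2 := Primrec.snd.comp Primrec.snd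
  have hn : Primrec fun x : (ℕ × ℕ) × (ℕ × ℕ) => x.2.1 - 1 :=
    Primrec.nat_sub.comp hi (Primrec.const 1)
  have hσ : Primrec fun x : (ℕ × ℕ) × (ℕ × ℕ) => ofNat (List ℕ) (x.2.1 - 1) :=
    (Primrec.ofNat _).comp hn
  have h_zero : PrimrecPred fun x : (ℕ × ℕ) × (ℕ × ℕ) => x.2.1 = 0 :=
    PrimrecRel.comp Primrec.eq hi (Primrec.const 0)
  have h_mem : PrimrecPred fun x : (ℕ × ℕ) × (ℕ × ℕ) =>
      ∃ z ∈ 0 :: ofNat (List ℕ) (x.2.1 - 1), z = x.2.2 :=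
    (PrimrecRel.exists_mem_list Primrec.eq).comp
      (Primrec.list_cons.comp (Primrec.const 0) hσ) hy
  have h_all : REPred fun x : (ℕ × ℕ) × (ℕ × ℕ) =>
      ∀ j < x.2.1 - 1, Unlocked (learnerOfCode x.1.1) (ofNat (List ℕ) j) :=
    REPred.forall_lt (rePred_unlocked (hm.to_comp.comp Computable.fst)
      ((Computable.ofNat _).comp Computable.snd)) hn.to_comp
  have h_W : REPred fun x : (ℕ × ℕ) × (ℕ × ℕ) => x.2.2 ∈ Wset x.1.2 :=
    rePred_mem_Wset he.to_comp hy.to_comp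
  have h_U : REPred fun x : (ℕ × ℕ) × (ℕ × ℕ) =>
      Unlocked (learnerOfCode x.1.1) (ofNat (List ℕ) (x.2.1 - 1)) :=
    rePred_unlocked hm.to_comp hσ.to_comp
  exact h_zero.computablePred.to_re.or
    (h_all.and (h_mem.computablePred.to_re.or (h_W.or h_U)))

theorem exists_computable_column_eq_diagonalSet :
    ∃ h : ℕ → ℕ → ℕ, Computable₂ h ∧ ∀ m e i, column (h m e) i = diagonalSet m e i := by
  obtain ⟨g, hg, H⟩ := exists_computable_Wset
    (p := fun a x => x.unpair.2 ∈ diagonalSet a.unpair.1 a.unpair.2 x.unpair.1)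
    (rePred_diagonalSet.comp
      ((Computable.unpair.comp Computable.fst).pair (Computable.unpair.comp Computable.snd)))
  refine ⟨fun m e => g (Nat.pair m e), hg.comp Primrec₂.natPair.to_comp, fun m e i => ?_⟩
  ext y
  simp [column, H]

section DiagonalSet

variable {m e : ℕ}

theorem diagonalSet_zero : diagonalSet m e 0 = Set.univ := by
  simp [diagonalSet]

theorem diagonalSet_succ_of_unlocked {n : ℕ}
    (h : ∀ j ≤ n, Unlocked (learnerOfCode m) (ofNat (List ℕ) j)) :
    diagonalSet m e (n + 1) = Set.univ := by
  ext y
  simp only [diagonalSet, Set.mem_ofPred_eq, Set.mem_univ, iff_true]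
  exact .inr ⟨fun j hj => h j hj.le, .inr (.inr (h n le_rfl))⟩

theorem diagonalSet_succ_of_lt {n k : ℕ} (hk : k < n)
    (h : ¬ Unlocked (learnerOfCode m) (ofNat (List ℕ) k)) :
    diagonalSet m e (n + 1) = ∅ := by
  ext y
  simp only [diagonalSet, Set.mem_ofPred_eq, Set.mem_empty_iff_false, iff_false]
  rintro (h' | ⟨h', -⟩)
  · omega
  · exact h (h' k hk)

theorem diagonalSet_succ_of_first {n : ℕ}
    (hlt : ∀ j < n, Unlocked (learnerOfCode m) (ofNat (List ℕ) j))
    (h : ¬ Unlocked (learnerOfCode m) (ofNat (List ℕ) n)) :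
    diagonalSet m e (n + 1) = {y | y ∈ 0 :: ofNat (List ℕ) n} ∪ Wset e := by
  ext y
  simp only [diagonalSet, Nat.add_sub_cancel, exists_eq_right, Set.mem_ofPred_eq, Set.mem_union,
    Nat.succ_ne_zero, false_or, h, or_false]
  exact and_iff_right hlt

theorem diagonalSet_eq_empty_or_superset (i : ℕ) :
    diagonalSet m e i = ∅ ∨ Wset e ⊆ diagonalSet m e i := by
  refine (Set.eq_empty_or_nonempty _).imp_right ?_
  rintro ⟨_, h | ⟨h, -⟩⟩ y hy
  · exact .inl h
  · exact .inr ⟨h, .inr (.inl hy)⟩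

end DiagonalSet

theorem infinite_compl_list_union {S : Set ℕ} (hS : Sᶜ.Infinite) (l : List ℕ) :
    (({y | y ∈ l} ∪ S)ᶜ).Infinite := by
  rw [Set.compl_union, Set.inter_comm, ← Set.sdiff_eq]
  exact hS.sdiff l.finite_toSet

theorem exists_learner_diagonalSet {m e : ℕ} (he : (Wset e)ᶜ.Infinite)
    (hce : ∀ i, ∃ b, Wset b = diagonalSet m e i) :
    ∃ M : List ℕ →. ℕ, Partrec M ∧ ∀ i, TxtExStarLearnsSet M (diagonalSet m e i) := by
  classical
  by_cases hU : ∃ n, ¬ Unlocked (learnerOfCode m) (ofNat (List ℕ) n)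
  · have hlt : ∀ j < Nat.find hU, Unlocked (learnerOfCode m) (ofNat (List ℕ) j) := fun j hj =>
      not_not.1 (Nat.find_min hU hj)
    have hn := Nat.find_spec hU
    generalize Nat.find hU = n at hlt hn
    obtain ⟨b, hb⟩ := hce (n + 1)
    have hb' : Wset b ≠ Set.univ := by
      rw [hb, diagonalSet_succ_of_first hlt hn]
      intro h
      exact infinite_compl_list_union he (0 :: ofNat (List ℕ) n)
        (by rw [h, Set.compl_univ]; exact Set.finite_empty)
    obtain ⟨M, hM, hM_univ, hM_b⟩ := exists_learner_univ_and b hb'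
    refine ⟨M, hM, fun i => ?_⟩
    cases i with
    | zero => rwa [diagonalSet_zero]
    | succ k =>
      rcases lt_trichotomy k n with hk | rfl | hk
      · rwa [diagonalSet_succ_of_unlocked fun j hj => hlt j (hj.trans_lt hk)]
      · rwa [← hb]
      · rw [diagonalSet_succ_of_lt hk hn]
        exact txtExStarLearnsSet_empty M
  · push Not at hU
    obtain ⟨u, hu⟩ := exists_Wset_eq_univ
    refine ⟨fun _ => Part.some u, (Computable.const u).partrec, fun i => ?_⟩
    apply txtExStarLearnsSet_const hu
    cases i with
    | zero => simp [diagonalSet_zero]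
    | succ k => simp [diagonalSet_succ_of_unlocked fun j _ => hU j]

theorem not_learns_diagonalSet {m e : ℕ} (he : (Wset e)ᶜ.Infinite) :
    ¬ ∀ i, TxtExStarLearnsSet (learnerOfCode m) (diagonalSet m e i) := by
  classical
  intro hM
  have h₀ := hM 0
  rw [diagonalSet_zero] at h₀
  obtain ⟨σ, hσ⟩ := exists_not_unlocked h₀
  have hU : ∃ n, ¬ Unlocked (learnerOfCode m) (ofNat (List ℕ) n) :=
    ⟨Encodable.encode σ, by rwa [ofNat_encode]⟩
  have hlt : ∀ j < Nat.find hU, Unlocked (learnerOfCode m) (ofNat (List ℕ) j) := fun j hj =>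
    not_not.1 (Nat.find_min hU hj)
  have hn := Nat.find_spec hU
  generalize Nat.find hU = n at hlt hn
  have h₁ := hM (n + 1)
  rw [diagonalSet_succ_of_first hlt hn] at h₁
  have hfin := symmDiff_finite_of_not_unlocked hn Set.univ_nonempty ⟨0, by simp⟩
    (fun _ _ => Set.mem_univ _) (fun x hx => .inl (List.mem_cons_of_mem _ hx)) h₀ h₁
  rw [← Set.top_eq_univ, top_symmDiff] at hfin
  exact infinite_compl_list_union he _ hfin

end TxtExStar

/-- There is a computable `h` such that `h m e` codes a u.c.e. family which,
when `W_e` is coinfinite, is TxtEx*-learnable but not by the `m`-th learner,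
and a single computable learner `N` TxtEx*-learns all the families `h m e`
with `W_e` cofinite. -/
theorem txtExStar_diagonal_family :
    ∃ h : ℕ → ℕ → ℕ, Computable₂ h ∧
      (∀ m e : ℕ, (Wset e)ᶜ.Infinite →
        (∃ M : List ℕ →. ℕ, Partrec M ∧
          ∀ i, TxtExStarLearnsSet M (column (h m e) i)) ∧
        ¬ (∀ i, TxtExStarLearnsSet (learnerOfCode m) (column (h m e) i))) ∧
      (∃ N : List ℕ →. ℕ, Partrec N ∧
        ∀ m e : ℕ, (Wset e)ᶜ.Finite →
          ∀ i, TxtExStarLearnsSet N (column (h m e) i)) := by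
  obtain ⟨h, hh, hcol⟩ := TxtExStar.exists_computable_column_eq_diagonalSet
  refine ⟨h, hh, fun m e he => ?_, ?_⟩
  · simp only [hcol]
    exact ⟨TxtExStar.exists_learner_diagonalSet he fun i =>
      hcol m e i ▸ TxtExStar.exists_column_eq_Wset (h m e) i,
      TxtExStar.not_learns_diagonalSet he⟩
  · obtain ⟨u, hu⟩ := TxtExStar.exists_Wset_eq_univ
    refine ⟨fun _ => Part.some u, (Computable.const u).partrec, fun m e he i => ?_⟩
    rw [hcol]
    rcases TxtExStar.diagonalSet_eq_empty_or_superset (m := m) (e := e) i with hi | hi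
    · rw [hi]
      exact TxtExStar.txtExStarLearnsSet_empty _
    · exact TxtExStar.txtExStarLearnsSet_const hu (he.subset (Set.compl_subset_compl.2 hi))
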